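/- For every multisegment m, the bar involution satisfies: bar(P(m)) ∈ P(m) + Σ_{n <_cry m} K·P(n), where the sum is over multisegments n with n <_cry m. -/

import Mathlib

/-! Basic setup: `K = ℚ(q)` and the algebra `U_q^-(gl_∞)`. -/

noncomputable section

/-- The base field `K = ℚ(q)`. -/
abbrev K : Type := RatFunc ℚ

/-- The indeterminate `q`. -/
def q : K := RatFunc.X

/-- The `q`-integer `[n]`. -/
def qint (n : ℤ) : K := (q ^ n - q ^ (-n)) / (q - q⁻¹)

/-- The `q`-factorial `[n]!`. -/
def qfact (n : ℕ) : K := ∏ k ∈ Finset.range n, qint (k + 1)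

/-- The `q`-Serre relations defining `U_q^-(gl_∞)`; the generator indexed by `a : ℤ`
corresponds to `f_i` for the odd integer `i = 2a+1`, so that `|i - j| > 2 ↔ 1 < |a - b|`
and `|i - j| = 2 ↔ |a - b| = 1`. -/
inductive URel : FreeAlgebra K ℤ → FreeAlgebra K ℤ → Prop
  | far (a b : ℤ) (h : 1 < |a - b|) :
      URel (FreeAlgebra.ι K a * FreeAlgebra.ι K b) (FreeAlgebra.ι K b * FreeAlgebra.ι K a)
  | serre (a b : ℤ) (h : |a - b| = 1) :
      URel (FreeAlgebra.ι K a * FreeAlgebra.ι K a * FreeAlgebra.ι K b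
            + FreeAlgebra.ι K b * (FreeAlgebra.ι K a * FreeAlgebra.ι K a))
           ((q + q⁻¹) • (FreeAlgebra.ι K a * FreeAlgebra.ι K b * FreeAlgebra.ι K a))

/-- The algebra `U_q^-(gl_∞)`. -/
abbrev U : Type := RingQuot URel

/-- The generator `f_i` of `U_q^-(gl_∞)`, for an odd integer `i`. -/
def fgen (i : ℤ) : U := RingQuot.mkAlgHom K URel (FreeAlgebra.ι K ((i - 1) / 2))

/-- `segAux i n` is the segment `⟨i, i+2n⟩`. -/
def segAux (i : ℤ) : ℕ → U
  | 0 => fgen i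
  | n + 1 => segAux i n * fgen (i + 2 * (n + 1)) - q • (fgen (i + 2 * (n + 1)) * segAux i n)

/-- The segment `⟨i,j⟩ ∈ U_q^-(gl_∞)` for odd `i ≤ j`. -/
def seg (i j : ℤ) : U := segAux i ((j - i) / 2).toNat

/-- The divided power `⟨i,j⟩^{(n)}` (zero for `n < 0`). -/
def segPow (i j : ℤ) (n : ℤ) : U :=
  if n < 0 then 0 else (qfact n.toNat)⁻¹ • seg i j ^ n.toNat

/-- The modified divided power `⟨i,j⟩^{[n]}`. -/
def segPowM (i j : ℤ) (n : ℤ) : U :=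
  if i = -j then
    (if n < 0 then 0 else (∏ ν ∈ Finset.range n.toNat, qint (2 * (ν + 1)))⁻¹ • seg i j ^ n.toNat)
  else segPow i j n


open scoped Classical

/-- Multisegments as elements of the free abelian group on the segments `⟨i,j⟩`. -/
abbrev MS : Type := (ℤ × ℤ) →₀ ℤ

/-- The segment `⟨i,j⟩` viewed as a multisegment. -/
def sg (i j : ℤ) : MS := Finsupp.single (i, j) 1

/-- `m` is a multisegment: supported on pairs of odd integers `i ≤ j`,
with nonnegative multiplicities. -/
def IsMulti (m : MS) : Prop :=
  ∀ i j : ℤ, m (i, j) ≠ 0 → Odd i ∧ Odd j ∧ i ≤ j ∧ 0 < m (i, j)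

/-- `m` is a θ-restricted multisegment (`m_{i,j} = 0` unless `−j ≤ i ≤ j`). -/
def IsTheta (m : MS) : Prop :=
  ∀ i j : ℤ, m (i, j) ≠ 0 → Odd i ∧ Odd j ∧ -j ≤ i ∧ i ≤ j ∧ 0 < m (i, j)

/-- The pairs `(i,j)` in the box `[-N,N]²`, listed in decreasing PBW order,
i.e. decreasing lexicographic order in `(j,i)`. -/
def box (N : ℕ) : List (ℤ × ℤ) :=
  (List.range (2 * N + 1)).flatMap fun a =>
    (List.range (2 * N + 1)).map fun b => (((N : ℤ) - b, (N : ℤ) - a))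

/-- A bound on the support of `m`. -/
def bound (m : MS) : ℕ := m.support.sup fun p => max p.1.natAbs p.2.natAbs

/-- The product of the modified divided powers `⟨i,j⟩^{[m_{i,j}]}` over the segments
appearing in `m`, in decreasing PBW order. -/
def PthetaProd (m : MS) : U := ((box (bound m)).map fun p => segPowM p.1 p.2 (m p)).prod

/-- `P_θ(m)` for a θ-restricted multisegment `m`; it is `0` if `m` is not a
θ-restricted multisegment. -/
def Ptheta (m : MS) : U := if IsTheta m then PthetaProd m else 0

/-- The product of the divided powers `⟨i,j⟩^{(m_{i,j})}` over the segments of `m`,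
in decreasing PBW order; this is `P(m)` for a multisegment `m`. -/
def Pms (m : MS) : U := ((box (bound m)).map fun p => segPow p.1 p.2 (m p)).prod

/-- The crystal ordering `m' <_cry m` on multisegments. -/
def CryLt (m' m : MS) : Prop :=
  ∃ i0 j0 : ℤ, i0 ≤ j0 ∧ m' (i0, j0) < m (i0, j0) ∧
    (∀ i : ℤ, i < i0 → m' (i, j0) = m (i, j0)) ∧
    (∀ i j : ℤ, j0 < j → i ≤ j → m' (i, j) = m (i, j))

theorem q_ne_zero : q ≠ 0 := RatFunc.X_ne_zero

theorem q_pow_ne_one {n : ℕ} (hn : n ≠ 0) : q ^ n ≠ 1 := by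
  intro h
  have h1 : algebraMap (Polynomial ℚ) (RatFunc ℚ) (Polynomial.X ^ n) =
      algebraMap (Polynomial ℚ) (RatFunc ℚ) 1 := by
    rw [map_pow, RatFunc.algebraMap_X, map_one]
    exact h
  have h2 := congrArg Polynomial.natDegree (RatFunc.algebraMap_injective ℚ h1)
  rw [Polynomial.natDegree_X_pow, Polynomial.natDegree_one] at h2
  exact hn h2

theorem q_sub_inv_ne_zero : q - q⁻¹ ≠ 0 := by
  intro h
  apply q_pow_ne_one (n := 2) two_ne_zero
  have h0 := q_ne_zero
  field_simp at h
  linear_combination h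

theorem q_add_inv_ne_zero : q + q⁻¹ ≠ 0 := by
  intro h
  apply q_pow_ne_one (n := 4) four_ne_zero
  have h0 := q_ne_zero
  field_simp at h
  linear_combination (q ^ 2 - 1) * h

theorem qint_succ_ne_zero (n : ℕ) : qint (n + 1) ≠ 0 := by
  have h0 := q_ne_zero
  refine div_ne_zero (fun h => q_pow_ne_one (n := 2 * (n + 1)) (by omega) ?_) q_sub_inv_ne_zero
  rw [zpow_neg, sub_eq_zero, ← mul_eq_one_iff_eq_inv₀ (zpow_ne_zero _ h0), ← zpow_add₀ h0] at h
  rw [← h, ← zpow_natCast]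
  congr 1
  push_cast
  ring

theorem qfact_succ (n : ℕ) : qfact (n + 1) = qfact n * qint (n + 1) :=
  Finset.prod_range_succ _ _

section Algebra

variable {F R : Type*} [Field F] [Ring R] [Algebra F R]

theorem mul_qbracket_of_serre {t : F} {a b : R}
    (h : a * a * b + b * (a * a) = (t + t⁻¹) • (a * b * a)) (ht : t ≠ 0) :
    a * (a * b - t • (b * a)) = t⁻¹ • ((a * b - t • (b * a)) * a) := by
  have h' := eq_sub_of_add_eq h
  simp only [mul_sub, sub_mul, mul_smul_comm, smul_mul_assoc, smul_sub, smul_smul, add_smul,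
    ← mul_assoc, inv_mul_cancel₀ ht, one_smul] at h' ⊢
  rw [h']
  abel

theorem qbracket_mul_of_serre {t : F} {a b : R}
    (h : b * b * a + a * (b * b) = (t + t⁻¹) • (b * a * b)) (ht : t ≠ 0) :
    (a * b - t • (b * a)) * b = t⁻¹ • (b * (a * b - t • (b * a))) := by
  have h' := eq_sub_of_add_eq' h
  simp only [mul_sub, sub_mul, mul_smul_comm, smul_mul_assoc, smul_sub, smul_smul, add_smul,
    ← mul_assoc, inv_mul_cancel₀ ht, one_smul] at h' ⊢
  rw [h']
  abel

theorem commute_qbracket_of_serre {t : F} {a b c : R} (ht : t ≠ 0) (ht' : t + t⁻¹ ≠ 0)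
    (hac : a * c = c * a)
    (h₁ : b * b * a + a * (b * b) = (t + t⁻¹) • (b * a * b))
    (h₂ : b * b * c + c * (b * b) = (t + t⁻¹) • (b * c * b)) :
    Commute b ((a * b - t • (b * a)) * c - t • (c * (a * b - t • (b * a)))) := by
  have e₁ : (t + t⁻¹) • (b * a * b * c) = b * b * a * c + a * b * b * c := by
    rw [← smul_mul_assoc, ← h₁]; noncomm_ring
  have e₂ : (t + t⁻¹) • (b * c * b * a) = b * b * a * c + c * b * b * a := by
    rw [← smul_mul_assoc, ← h₂, mul_assoc (b * b) a c, hac]; noncomm_ring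
  have e₃ : (t + t⁻¹) • (a * b * c * b) = a * b * b * c + c * a * b * b := by
    rw [mul_assoc a b c, mul_assoc a (b * c) b, ← mul_smul_comm, ← h₂, ← hac]; noncomm_ring
  have e₄ : (t + t⁻¹) • (c * b * a * b) = c * b * b * a + c * a * b * b := by
    rw [mul_assoc c b a, mul_assoc c (b * a) b, ← mul_smul_comm, ← h₁]; noncomm_ring
  have e₅ : b * c * a * b = b * a * c * b := by rw [mul_assoc b c a, ← hac, mul_assoc b a c]
  have key : (t + t⁻¹) • (b * ((a * b - t • (b * a)) * c - t • (c * (a * b - t • (b * a))))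
      - ((a * b - t • (b * a)) * c - t • (c * (a * b - t • (b * a)))) * b) = 0 := by
    have : b * ((a * b - t • (b * a)) * c - t • (c * (a * b - t • (b * a))))
        - ((a * b - t • (b * a)) * c - t • (c * (a * b - t • (b * a)))) * b
        = b * a * b * c - t • (b * b * a * c) + (t * t) • (b * c * b * a) - a * b * c * b
          + t • (c * a * b * b) - (t * t) • (c * b * a * b) := by
      simp only [mul_sub, sub_mul, mul_smul_comm, smul_mul_assoc, smul_sub, smul_smul, ← mul_assoc,
        e₅]
      abel
    rw [this]
    have e₆ (x : R) : (t + t⁻¹) • t • x = (t * t + 1) • x := by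
      rw [smul_smul, add_mul, inv_mul_cancel₀ ht]
    linear_combination (norm := module) e₁ + (t * t) • e₂ - e₃ - (t * t) • e₄ - e₆ (b * b * a * c)
      + e₆ (c * a * b * b)
  exact sub_eq_zero.1 ((smul_eq_zero.1 key).resolve_left ht')

theorem Commute.qbracket_right {t : F} {y u v : R} (hu : Commute y u) (hv : Commute y v) :
    Commute y (u * v - t • (v * u)) :=
  (hu.mul_right hv).sub_right ((hv.mul_right hu).smul_right t)

theorem mul_qbracket_of_qcommute {s t : F} {y u v : R} (hu : y * u = s • (u * y))
    (hv : y * v = v * y) :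
    y * (u * v - t • (v * u)) = s • ((u * v - t • (v * u)) * y) := by
  have e₁ : y * (u * v) = s • (u * v * y) := by
    rw [← mul_assoc, hu, smul_mul_assoc, mul_assoc, hv, mul_assoc]
  have e₂ : y * (v * u) = s • (v * u * y) := by
    rw [← mul_assoc, hv, mul_assoc, hu, mul_smul_comm, mul_assoc]
  rw [mul_sub, mul_smul_comm, e₁, e₂, sub_mul, smul_sub, smul_mul_assoc, smul_comm s t]

theorem mul_qbracket_of_qcommute' {s t : F} {y u v : R} (hu : y * u = u * y)
    (hv : y * v = s • (v * y)) :
    y * (u * v - t • (v * u)) = s • ((u * v - t • (v * u)) * y) := by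
  have e₁ : y * (u * v) = s • (u * v * y) := by
    rw [← mul_assoc, hu, mul_assoc, hv, mul_smul_comm, mul_assoc]
  have e₂ : y * (v * u) = s • (v * u * y) := by
    rw [← mul_assoc, hv, smul_mul_assoc, mul_assoc, hu, mul_assoc]
  rw [mul_sub, mul_smul_comm, e₁, e₂, sub_mul, smul_sub, smul_mul_assoc, smul_comm s t]

theorem qbracket_mul_of_qcommute {s t : F} {y u v : R} (hu : u * y = s • (y * u))
    (hv : v * y = y * v) :
    (v * u - t • (u * v)) * y = s • (y * (v * u - t • (u * v))) := by
  have e₁ : u * v * y = s • (y * (u * v)) := by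
    rw [mul_assoc, hv, ← mul_assoc, hu, smul_mul_assoc, mul_assoc]
  have e₂ : v * u * y = s • (y * (v * u)) := by
    rw [mul_assoc, hu, mul_smul_comm, ← mul_assoc, hv, mul_assoc]
  rw [sub_mul, smul_mul_assoc, e₁, e₂, mul_sub, smul_sub, mul_smul_comm, smul_comm s t]

end Algebra

theorem commute_fgen {i k : ℤ} (hi : Odd i) (hk : Odd k) (h : 2 < |i - k|) :
    Commute (fgen i) (fgen k) := by
  obtain ⟨a, rfl⟩ := hi
  obtain ⟨b, rfl⟩ := hk
  have := RingQuot.mkAlgHom_rel K (URel.far a b (by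
    rw [lt_abs] at h ⊢; omega))
  rw [map_mul, map_mul] at this
  simpa [fgen, Commute, SemiconjBy] using this

theorem fgen_serre {i k : ℤ} (hi : Odd i) (hk : Odd k) (h : |i - k| = 2) :
    fgen i * fgen i * fgen k + fgen k * (fgen i * fgen i) =
      (q + q⁻¹) • (fgen i * fgen k * fgen i) := by
  obtain ⟨a, rfl⟩ := hi
  obtain ⟨b, rfl⟩ := hk
  have := RingQuot.mkAlgHom_rel K (URel.serre a b (by
    rw [abs_eq (by norm_num)] at h ⊢; omega))
  simp only [map_mul, map_add, map_smul] at this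
  simpa [fgen] using this

theorem Odd.add_two {i : ℤ} (hi : Odd i) : Odd (i + 2) := hi.add_even even_two

theorem Odd.sub_two {i : ℤ} (hi : Odd i) : Odd (i - 2) := hi.sub_even even_two

theorem odd_le_induction {i : ℤ} {p : ℤ → Prop} (hi : Odd i) (base : p i)
    (step : ∀ j, Odd j → i ≤ j → p j → p (j + 2)) {j : ℤ} (hj : Odd j) (hij : i ≤ j) : p j := by
  have key : ∀ n : ℕ, p (i + 2 * n) := by
    intro n
    induction n with
    | zero => simpa using base
    | succ n ih =>
      have := step _ (hi.add_even (even_two_mul _)) (by omega) ih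
      rwa [show i + 2 * ((n + 1 : ℕ) : ℤ) = i + 2 * n + 2 by push_cast; ring]
  obtain ⟨a, rfl⟩ := hi
  obtain ⟨b, rfl⟩ := hj
  have := key (b - a).toNat
  rwa [show 2 * a + 1 + 2 * ((b - a).toNat : ℤ) = 2 * b + 1 by omega] at this

theorem odd_le_induction_down {j : ℤ} {p : ℤ → Prop} (hj : Odd j) (base : p j)
    (step : ∀ i, Odd i → i + 2 ≤ j → p (i + 2) → p i) {i : ℤ} (hi : Odd i) (hij : i ≤ j) :
    p i := by
  have := odd_le_induction (i := -j) (p := fun k => p (-k)) hj.neg (by rwa [neg_neg])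
    (fun k hk hjk h => step _ hk.add_two.neg (by omega) (by
      rwa [show -(k + 2) + 2 = -k by ring])) (j := -i) hi.neg (by omega)
  rwa [neg_neg] at this

theorem seg_self (i : ℤ) : seg i i = fgen i := by simp [seg, segAux]

theorem seg_right {i j : ℤ} (hi : Odd i) (hj : Odd j) (hij : i ≤ j) :
    seg i (j + 2) = seg i j * fgen (j + 2) - q • (fgen (j + 2) * seg i j) := by
  obtain ⟨a, rfl⟩ := hi
  obtain ⟨b, rfl⟩ := hj
  obtain ⟨n, hn⟩ := Int.eq_ofNat_of_zero_le (show 0 ≤ b - a by omega)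
  have h₁ : ((2 * b + 1 + 2 - (2 * a + 1)) / 2).toNat = n + 1 := by omega
  have h₂ : ((2 * b + 1 - (2 * a + 1)) / 2).toNat = n := by omega
  have h₃ : 2 * a + 1 + 2 * ((n : ℤ) + 1) = 2 * b + 1 + 2 := by omega
  rw [seg, seg, h₁, h₂, segAux, h₃]

theorem seg_left {i j : ℤ} (hi : Odd i) (hj : Odd j) (hij : i + 2 ≤ j) :
    seg i j = fgen i * seg (i + 2) j - q • (seg (i + 2) j * fgen i) := by
  have hi2 : Odd (i + 2) := hi.add_two
  refine odd_le_induction (p := fun j => seg i j = fgen i * seg (i + 2) j -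
    q • (seg (i + 2) j * fgen i))
    hi2 ?_ (fun k hk hik ih => ?_) hj hij
  · rw [seg_right hi hi le_rfl, seg_self, seg_self]
  · have hk2 : Odd (k + 2) := hk.add_two
    have hc := (commute_fgen hi hk2 (by rw [lt_abs]; omega)).eq
    rw [seg_right hi hk (by omega), seg_right hi2 hk hik, ih]
    generalize seg (i + 2) k = x at *
    generalize fgen i = a at *
    generalize fgen (k + 2) = b at *
    have e₁ : b * (a * x) = a * (b * x) := by rw [← mul_assoc, ← hc, mul_assoc]
    simp only [mul_sub, sub_mul, mul_smul_comm, smul_mul_assoc, smul_sub, mul_assoc, hc, e₁]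
    abel

theorem Commute.seg_right {y : U} {i j : ℤ} (hi : Odd i) (hj : Odd j) (hij : i ≤ j)
    (h : ∀ k, Odd k → i ≤ k → k ≤ j → Commute y (fgen k)) : Commute y (seg i j) := by
  revert h
  refine odd_le_induction (p := fun j => (∀ k, Odd k → i ≤ k → k ≤ j → Commute y (fgen k)) →
    Commute y (seg i j)) hi (fun h => ?_) (fun k hk hik ih h => ?_) hj hij
  · rw [seg_self]; exact h i hi le_rfl le_rfl
  · rw [_root_.seg_right hi hk hik]
    exact (ih fun l hl h1 h2 => h l hl h1 (by omega)).qbracket_right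
      (h _ (hk.add_two) (by omega) le_rfl)

theorem fgen_mul_seg_same {i j : ℤ} (hi : Odd i) (hj : Odd j) (hij : i + 2 ≤ j) :
    fgen i * seg i j = q⁻¹ • (seg i j * fgen i) := by
  have hi2 : Odd (i + 2) := hi.add_two
  refine odd_le_induction (p := fun j => fgen i * seg i j = q⁻¹ • (seg i j * fgen i))
    hi2 ?_ (fun k hk hik ih => ?_) hj hij
  · rw [seg_right hi hi le_rfl, seg_self]
    exact mul_qbracket_of_serre (fgen_serre hi hi2 (by simp)) q_ne_zero
  · have hk2 : Odd (k + 2) := hk.add_two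
    rw [seg_right hi hk (by omega)]
    exact mul_qbracket_of_qcommute ih (commute_fgen hi hk2 (by rw [lt_abs]; omega)).eq

theorem seg_mul_fgen_same {i j : ℤ} (hi : Odd i) (hj : Odd j) (hij : i + 2 ≤ j) :
    seg i j * fgen j = q⁻¹ • (fgen j * seg i j) := by
  have hj2 : Odd (j - 2) := hj.sub_two
  refine odd_le_induction_down (p := fun i => seg i j * fgen j = q⁻¹ • (fgen j * seg i j))
    hj2 ?_ (fun k hk hik ih => ?_) hi (by omega)
  · have := seg_right hj2 hj2 le_rfl
    rw [sub_add_cancel, seg_self] at this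
    rw [this]
    exact qbracket_mul_of_serre (fgen_serre hj hj2 (by simp)) q_ne_zero
  · rw [seg_left hk hj (by omega)]
    exact qbracket_mul_of_qcommute ih (commute_fgen hk hj (by rw [lt_abs]; omega)).eq

theorem commute_fgen_seg_of_lt {k i j : ℤ} (hk : Odd k) (hi : Odd i) (hj : Odd j) (hij : i ≤ j)
    (h : k + 2 < i) : Commute (fgen k) (seg i j) :=
  Commute.seg_right hi hj hij fun l hl h1 _ => commute_fgen hk hl (by rw [lt_abs]; omega)

theorem commute_fgen_seg_of_mem {k i j : ℤ} (hk : Odd k) (hi : Odd i) (hj : Odd j)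
    (hik : i + 2 ≤ k) (hkj : k + 2 ≤ j) : Commute (fgen k) (seg i j) := by
  have hk2 : Odd (k - 2) := hk.sub_two
  have hk2' : Odd (k + 2) := hk.add_two
  refine odd_le_induction_down (p := fun i => Commute (fgen k) (seg i j))
    hk2 ?_ (fun l hl hlk ih => ?_) hi (by omega)
  · refine odd_le_induction (p := fun j => Commute (fgen k) (seg (k - 2) j))
      hk2' ?_ (fun l hl hkl ih => ?_) hj hkj
    · have := seg_right hk2 hk2 le_rfl
      rw [sub_add_cancel, seg_self] at this
      rw [seg_right hk2 hk (by omega), this]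
      exact commute_qbracket_of_serre q_ne_zero q_add_inv_ne_zero
        (commute_fgen hk2 hk2' (by rw [lt_abs]; omega)).eq
        (fgen_serre hk hk2 (by simp)) (fgen_serre hk hk2' (by simp))
    · rw [seg_right hk2 hl (by omega)]
      exact ih.qbracket_right
        (commute_fgen hk (hl.add_two) (by rw [lt_abs]; omega))
  · rw [seg_left hl hj (by omega)]
    exact (commute_fgen hk hl (by rw [lt_abs]; omega)).qbracket_right ih

theorem seg_mul_seg {i l j : ℤ} (hi : Odd i) (hl : Odd l) (hj : Odd j) (hil : i + 2 ≤ l)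
    (hlj : l ≤ j) : seg i j * seg l j = q⁻¹ • (seg l j * seg i j) := by
  obtain rfl | h := eq_or_ne l j
  · rw [seg_self]; exact seg_mul_fgen_same hi hl hil
  · have hj2 : Odd (j - 2) := hj.sub_two
    have hlj2 : l ≤ j - 2 := by
      obtain ⟨a, rfl⟩ := hl
      obtain ⟨b, rfl⟩ := hj
      omega
    have hc : Commute (seg i j) (seg l (j - 2)) := Commute.seg_right hl hj2 hlj2
      fun k hk h1 h2 => (commute_fgen_seg_of_mem hk hi hj (by omega) (by omega)).symm
    have := seg_right hl hj2 hlj2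
    rw [sub_add_cancel] at this
    rw [this]
    exact mul_qbracket_of_qcommute' hc.eq (seg_mul_fgen_same hi hj (by omega))

theorem mem_span_of_generators {M N : Type*} [AddCommGroup M] [Module K M] [AddCommGroup N]
    [Module K N] {s : Set M} {p : Submodule K N} (f : M →ₗ[K] N) (h : ∀ x ∈ s, f x ∈ p)
    {x : M} (hx : x ∈ Submodule.span K s) : f x ∈ p :=
  (Submodule.span_le.2 h : Submodule.span K s ≤ p.comap f) hx

/-- The subalgebra generated by the `f_k` with `i ≤ k < j`. -/
def fAlg (i j : ℤ) : Subalgebra K U :=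
  Algebra.adjoin K {x | ∃ k, Odd k ∧ i ≤ k ∧ k < j ∧ x = fgen k}

theorem fgen_mem_fAlg {i j k : ℤ} (hk : Odd k) (hik : i ≤ k) (hkj : k < j) :
    fgen k ∈ fAlg i j :=
  Algebra.subset_adjoin ⟨k, hk, hik, hkj, rfl⟩

theorem fAlg_mono {i i' j j' : ℤ} (hi : i' ≤ i) (hj : j ≤ j') : fAlg i j ≤ fAlg i' j' :=
  Algebra.adjoin_mono fun _ ⟨k, hk, h1, h2, hx⟩ => ⟨k, hk, by omega, by omega, hx⟩

theorem seg_mem_fAlg {i j i' j' : ℤ} (hi : Odd i) (hj : Odd j) (hij : i ≤ j) (hi' : i' ≤ i)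
    (hj' : j < j') : seg i j ∈ fAlg i' j' := by
  revert hj'
  refine odd_le_induction (p := fun j => j < j' → seg i j ∈ fAlg i' j') hi (fun h => ?_)
    (fun k hk hik ih h => ?_) hj hij
  · rw [seg_self]; exact fgen_mem_fAlg hi hi' h
  · have h₁ := fgen_mem_fAlg hk.add_two (i := i') (by omega) h
    have h₂ := ih (by omega)
    rw [seg_right hi hk hik]
    exact sub_mem (mul_mem h₂ h₁) (Subalgebra.smul_mem _ (mul_mem h₁ h₂) _)

/-- The right `fAlg i j`-module generated by the segments `⟨l,j⟩` with `l₀ ≤ l ≤ j`. -/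
def segSpan (l₀ i j : ℤ) : Submodule K U :=
  Submodule.span K {x | ∃ l, Odd l ∧ l₀ ≤ l ∧ l ≤ j ∧ ∃ a ∈ fAlg i j, x = seg l j * a}

theorem seg_mul_mem_segSpan {l₀ i j l : ℤ} {a : U} (hl : Odd l) (h₁ : l₀ ≤ l) (h₂ : l ≤ j)
    (ha : a ∈ fAlg i j) : seg l j * a ∈ segSpan l₀ i j :=
  Submodule.subset_span ⟨l, hl, h₁, h₂, a, ha, rfl⟩

theorem seg_mem_segSpan {l₀ i j l : ℤ} (hl : Odd l) (h₁ : l₀ ≤ l) (h₂ : l ≤ j) :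
    seg l j ∈ segSpan l₀ i j := by
  simpa using seg_mul_mem_segSpan (i := i) hl h₁ h₂ (one_mem _)

theorem segSpan_mono {l₀ l₁ i i' j : ℤ} (hl : l₁ ≤ l₀) (hi : i' ≤ i) :
    segSpan l₀ i j ≤ segSpan l₁ i' j :=
  Submodule.span_mono fun _ ⟨l, hl, h1, h2, a, ha, hx⟩ =>
    ⟨l, hl, by omega, h2, a, fAlg_mono hi le_rfl ha, hx⟩

theorem segSpan_mul_mem {l₀ i j : ℤ} {y a : U} (hy : y ∈ segSpan l₀ i j) (ha : a ∈ fAlg i j) :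
    y * a ∈ segSpan l₀ i j := by
  refine mem_span_of_generators (LinearMap.mulRight K a) ?_ hy
  rintro _ ⟨l, hl, h1, h2, b, hb, rfl⟩
  rw [LinearMap.mulRight_apply, mul_assoc]
  exact seg_mul_mem_segSpan hl h1 h2 (mul_mem hb ha)

theorem fgen_mul_seg_mem {i j k l : ℤ} (hj : Odd j) (hk : Odd k) (hik : i ≤ k) (hkj : k < j)
    (hl : Odd l) (hil : i ≤ l) (hlj : l ≤ j) : fgen k * seg l j ∈ segSpan i i j := by
  have hf : fgen k ∈ fAlg i j := fgen_mem_fAlg hk hik hkj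
  have hlf : seg l j * fgen k ∈ segSpan i i j := seg_mul_mem_segSpan hl hil hlj hf
  obtain h | h | h | h : k + 2 < l ∨ k + 2 = l ∨ k = l ∨ l + 2 ≤ k ∧ k + 2 ≤ j := by
    obtain ⟨a, rfl⟩ := hk
    obtain ⟨b, rfl⟩ := hl
    obtain ⟨c, rfl⟩ := hj
    omega
  · rwa [(commute_fgen_seg_of_lt hk hl hj hlj h).eq]
  · subst h
    rw [← sub_add_cancel (fgen k * seg (k + 2) j) (q • (seg (k + 2) j * fgen k)),
      ← seg_left hk hj hlj]
    exact add_mem (seg_mem_segSpan hk hik hkj.le) (Submodule.smul_mem _ _ hlf)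
  · subst h
    rw [fgen_mul_seg_same hk hj (by
      obtain ⟨a, rfl⟩ := hk
      obtain ⟨c, rfl⟩ := hj
      omega)]
    exact Submodule.smul_mem _ _ hlf
  · rwa [(commute_fgen_seg_of_mem hk hl hj h.1 h.2).eq]

theorem mul_mem_segSpan {i j : ℤ} (hj : Odd j) {a y : U} (ha : a ∈ fAlg i j)
    (hy : y ∈ segSpan i i j) : a * y ∈ segSpan i i j := by
  induction ha using Algebra.adjoin_induction generalizing y with
  | mem x hx =>
    obtain ⟨k, hk, hik, hkj, rfl⟩ := hx
    refine mem_span_of_generators (LinearMap.mulLeft K (fgen k)) ?_ hy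
    rintro _ ⟨l, hl, h1, h2, b, hb, rfl⟩
    rw [LinearMap.mulLeft_apply, ← mul_assoc]
    exact segSpan_mul_mem (fgen_mul_seg_mem hj hk hik hkj hl h1 h2) hb
  | algebraMap r => rw [← Algebra.smul_def]; exact Submodule.smul_mem _ _ hy
  | add a b _ _ ha hb => rw [add_mul]; exact add_mem (ha hy) (hb hy)
  | mul a b _ _ ha hb => rw [mul_assoc]; exact ha (hb hy)

theorem fgen_mul_mem_segSpan {i j : ℤ} (hi : Odd i) (hj : Odd j) {y : U}
    (hy : y ∈ segSpan (i + 4) i j) : fgen i * y ∈ segSpan (i + 4) i j := by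
  refine mem_span_of_generators (LinearMap.mulLeft K (fgen i)) ?_ hy
  rintro _ ⟨l, hl, h1, h2, b, hb, rfl⟩
  rw [LinearMap.mulLeft_apply, ← mul_assoc, (commute_fgen_seg_of_lt hi hl hj h2 (by omega)).eq,
    mul_assoc]
  exact seg_mul_mem_segSpan hl h1 h2 (mul_mem (fgen_mem_fAlg hi le_rfl (by omega)) hb)

section Bar

variable {bar : U →+* U}

theorem bar_algebraMap_inv {a b : K} (ha : a ≠ 0) (hb : b ≠ 0)
    (h : bar (algebraMap K U a) = algebraMap K U b) :
    bar (algebraMap K U a⁻¹) = algebraMap K U b⁻¹ := by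
  have h1 : algebraMap K U b * bar (algebraMap K U a⁻¹) = 1 := by
    rw [← h, ← map_mul, ← map_mul, mul_inv_cancel₀ ha, map_one, map_one]
  calc bar (algebraMap K U a⁻¹)
      = algebraMap K U (b⁻¹ * b) * bar (algebraMap K U a⁻¹) := by
        rw [inv_mul_cancel₀ hb, map_one, one_mul]
    _ = algebraMap K U b⁻¹ := by rw [map_mul, mul_assoc, h1, mul_one]

variable (hbarq : bar (algebraMap K U q) = algebraMap K U q⁻¹)
include hbarq

theorem bar_q_inv : bar (algebraMap K U q⁻¹) = algebraMap K U q := by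
  simpa using bar_algebraMap_inv q_ne_zero (inv_ne_zero q_ne_zero) hbarq

theorem bar_qint (n : ℕ) : bar (algebraMap K U (qint (n + 1))) = algebraMap K U (qint (n + 1)) := by
  have h₁ : bar (algebraMap K U (q - q⁻¹)) = algebraMap K U (-(q - q⁻¹)) := by
    rw [map_sub, map_sub, hbarq, bar_q_inv hbarq, ← map_sub, neg_sub]
  have h₂ := bar_algebraMap_inv q_sub_inv_ne_zero (neg_ne_zero.2 q_sub_inv_ne_zero) h₁
  have h₃ : qint (n + 1) = (q ^ (n + 1) - q⁻¹ ^ (n + 1)) * (q - q⁻¹)⁻¹ := by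
    rw [qint, div_eq_mul_inv, zpow_neg, inv_pow, ← zpow_natCast]
    push_cast
    rfl
  rw [h₃, map_mul, map_mul, h₂, map_sub, map_pow, map_pow, map_sub, map_pow, map_pow, hbarq,
    bar_q_inv hbarq, ← map_pow, ← map_pow, ← map_sub, ← map_sub, ← map_mul, ← map_mul]
  congr 1
  rw [← neg_sub (q ^ (n + 1)), inv_neg, neg_mul_neg]

variable (hbarf : ∀ i : ℤ, Odd i → bar (fgen i) = fgen i)
include hbarf

theorem bar_seg {i j : ℤ} (hi : Odd i) (hj : Odd j) (hij : i ≤ j) :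
    bar (seg i j) - seg i j ∈ segSpan (i + 2) i j := by
  refine odd_le_induction_down (p := fun i => bar (seg i j) - seg i j ∈ segSpan (i + 2) i j) hj ?_
    (fun k hk hkj ih => ?_) hi hij
  · rw [seg_self, hbarf j hj, sub_self]; exact zero_mem _
  · have hf : fgen k ∈ fAlg k j := fgen_mem_fAlg hk le_rfl (by omega)
    set x := seg (k + 2) j with hx
    obtain ⟨g, hg⟩ : ∃ g, g = bar x - x := ⟨_, rfl⟩
    rw [← hg] at ih
    have hg' : bar x = x + g := by rw [hg]; abel
    have ih' : g ∈ segSpan (k + 4) k j := segSpan_mono (by omega) (by omega) ih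
    have e : bar (seg k j) - seg k j =
        (q • (x * fgen k) - q⁻¹ • (x * fgen k)) + (fgen k * g - q⁻¹ • (g * fgen k)) := by
      rw [seg_left hk hj hkj, ← hx, map_sub, Algebra.smul_def q, map_mul, map_mul, map_mul, hbarq,
        hbarf k hk, hg', ← Algebra.smul_def, ← Algebra.smul_def, mul_add, add_mul]
      simp only [smul_add]
      abel
    have h := seg_mul_mem_segSpan hk.add_two le_rfl hkj hf
    rw [e]
    refine add_mem (sub_mem (Submodule.smul_mem _ _ h) (Submodule.smul_mem _ _ h))
      (segSpan_mono (l₀ := k + 4) (by omega) le_rfl ?_)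
    exact sub_mem (fgen_mul_mem_segSpan hk hj ih')
      (Submodule.smul_mem _ _ (segSpan_mul_mem ih' hf))

end Bar

theorem segPow_natCast (i j : ℤ) (n : ℕ) : segPow i j n = (qfact n)⁻¹ • seg i j ^ n := by
  simp [segPow]

theorem segPow_zero (i j : ℤ) : segPow i j 0 = 1 := by
  simpa [qfact] using segPow_natCast i j 0

theorem segPow_mul_seg (i j : ℤ) (n : ℕ) :
    segPow i j n * seg i j = qint (n + 1) • segPow i j (n + 1 : ℕ) := by
  rw [segPow_natCast, segPow_natCast, smul_mul_assoc, ← pow_succ, smul_smul, qfact_succ, mul_inv,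
    mul_comm (qfact n)⁻¹, mul_inv_cancel_left₀ (qint_succ_ne_zero n)]

theorem pow_mul_of_qcommute {s : K} {x y : U} (h : x * y = s • (y * x)) (n : ℕ) :
    x ^ n * y = s ^ n • (y * x ^ n) := by
  induction n with
  | zero => simp
  | succ n ih =>
    rw [pow_succ, mul_assoc, h, mul_smul_comm, ← mul_assoc, ih, smul_mul_assoc, smul_smul,
      mul_assoc, pow_succ, mul_comm]

/-- The product of the `⟨i,j⟩^{(c_i)}` over the `t` integers `i ≤ B` closest to `B`, in
decreasing order. -/
def colProd (B : ℕ) (j : ℤ) (t : ℕ) (c : ℤ → ℕ) : U :=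
  ((List.range t).map fun b : ℕ => segPow ((B : ℤ) - b) j (c ((B : ℤ) - b))).prod

/-- The product of the `⟨i,j⟩^{(c_i)}` over `-B ≤ i ≤ B`, in decreasing order. -/
def colMon (B : ℕ) (j : ℤ) (c : ℤ → ℕ) : U := colProd B j (2 * B + 1) c

/-- `c` is supported on odd integers between `i` and `j`. -/
def IsCol (i j : ℤ) (c : ℤ → ℕ) : Prop := ∀ k, c k ≠ 0 → Odd k ∧ i ≤ k ∧ k ≤ j

/-- The lexicographic order on columns. -/
def ColLt (c' c : ℤ → ℕ) : Prop := ∃ i, c' i < c i ∧ ∀ k < i, c' k = c k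

theorem IsCol.zero (i j : ℤ) : IsCol i j 0 := fun _ h => (h rfl).elim

theorem IsCol.mono {i i' j j' : ℤ} {c : ℤ → ℕ} (h : IsCol i j c) (hi : i' ≤ i) (hj : j ≤ j') :
    IsCol i' j' c := fun k hk => ⟨(h k hk).1, hi.trans (h k hk).2.1, (h k hk).2.2.trans hj⟩

theorem IsCol.add_single {i j l : ℤ} {c : ℤ → ℕ} (h : IsCol i j c) (hl : Odd l) (h₁ : i ≤ l)
    (h₂ : l ≤ j) : IsCol i j (c + Pi.single l 1) := by
  intro k hk
  by_cases hkl : k = l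
  · exact hkl ▸ ⟨hl, h₁, h₂⟩
  · exact h k (by simpa [Pi.single_apply, hkl] using hk)

theorem ColLt.single_add {c : ℤ → ℕ} {i l : ℤ} (h : i < l) :
    ColLt (c + Pi.single l 1) (c + Pi.single i 1) := by
  refine ⟨i, by simp [h.ne], fun k hk => ?_⟩
  simp [hk.ne, (hk.trans h).ne]

theorem ColLt.add_single {c' c : ℤ → ℕ} {i j l : ℤ} (h : ColLt c' c) (hc : IsCol i j c)
    (hil : i ≤ l) : ColLt (c' + Pi.single l 1) (c + Pi.single i 1) := by
  obtain ⟨k, hk, hk'⟩ := h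
  have hik : i ≤ k := (hc k (by omega)).2.1
  obtain rfl | hil := hil.eq_or_lt
  · exact ⟨k, by simpa using hk, fun n hn => by simp [hk' n hn]⟩
  · refine ⟨i, ?_, fun n hn => by simp [hk' n (hn.trans_le hik), hn.ne, (hn.trans hil).ne]⟩
    have : c' i ≤ c i := by
      obtain rfl | h := hik.eq_or_lt
      exacts [hk.le, (hk' i h).le]
    simp [hil.ne]
    omega

theorem colProd_succ (B : ℕ) (j : ℤ) (t : ℕ) (c : ℤ → ℕ) :
    colProd B j (t + 1) c = colProd B j t c * segPow ((B : ℤ) - t) j (c ((B : ℤ) - t)) := by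
  simp [colProd, List.range_succ]

theorem colProd_zero (B : ℕ) (j : ℤ) (t : ℕ) : colProd B j t 0 = 1 := by
  induction t with
  | zero => simp [colProd]
  | succ t ih => rw [colProd_succ, ih]; simp [segPow_zero]

theorem colProd_congr {B : ℕ} {j : ℤ} {t : ℕ} {c c' : ℤ → ℕ}
    (h : ∀ k, (B : ℤ) - t < k → c k = c' k) : colProd B j t c = colProd B j t c' := by
  refine congrArg List.prod (List.map_congr_left fun b hb => ?_)
  rw [List.mem_range] at hb
  rw [h _ (by omega)]

theorem segPow_mul_seg_of_lt {i j l : ℤ} {n : ℕ} (hi : Odd i) (hl : Odd l) (hj : Odd j)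
    (hil : i + 2 ≤ l) (hlj : l ≤ j) :
    segPow i j n * seg l j = q⁻¹ ^ n • (seg l j * segPow i j n) := by
  rw [segPow_natCast, smul_mul_assoc, pow_mul_of_qcommute (seg_mul_seg hi hl hj hil hlj),
    mul_smul_comm, smul_comm]

theorem colProd_mul_seg {B : ℕ} {i j : ℤ} (hj : Odd j) {c : ℤ → ℕ} (hc : IsCol i j c) {l : ℤ}
    (hl : Odd l) (hlj : l ≤ j) (hlB : l ≤ B) (t : ℕ) (ht : (B : ℤ) - t < l) :
    ∃ α : K, colProd B j t c * seg l j = α • colProd B j t (c + Pi.single l 1) ∧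
      ((∀ k < l, c k = 0) → α = qint (c l + 1)) := by
  induction t with
  | zero => push_cast at ht; omega
  | succ t ih =>
    rw [colProd_succ, colProd_succ]
    obtain h | h : (B : ℤ) - t = l ∨ (B : ℤ) - t < l := by push_cast at ht; omega
    · refine ⟨qint (c l + 1), ?_, fun _ => rfl⟩
      rw [h, mul_assoc, segPow_mul_seg, mul_smul_comm]
      congr 2
      · exact colProd_congr fun k hk => by simp [(h.symm.trans_lt hk).ne']
      · simp
    · obtain ⟨α, h₁, h₂⟩ := ih h
      have e : (c + Pi.single l 1 : ℤ → ℕ) ((B : ℤ) - t) = c ((B : ℤ) - t) := by simp [h.ne]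
      rw [e]
      by_cases h0 : c ((B : ℤ) - t) = 0
      · refine ⟨α, ?_, h₂⟩
        rw [h0, Nat.cast_zero, segPow_zero, mul_one, mul_one, h₁]
      · refine ⟨q⁻¹ ^ c ((B : ℤ) - t) * α, ?_, fun hz => (h0 (hz _ h)).elim⟩
        have ho := (hc _ h0).1
        rw [mul_assoc, segPow_mul_seg_of_lt ho hl hj (by
          obtain ⟨a, ha⟩ := ho
          obtain ⟨b, hb⟩ := hl
          omega) hlj, mul_smul_comm, ← mul_assoc, h₁, smul_mul_assoc, smul_smul]

theorem colMon_mul_seg {B : ℕ} {i j : ℤ} (hj : Odd j) {c : ℤ → ℕ} (hc : IsCol i j c) {l : ℤ}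
    (hl : Odd l) (hlj : l ≤ j) (hlB : l ≤ B) (hBl : -(B : ℤ) ≤ l) :
    ∃ α : K, colMon B j c * seg l j = α • colMon B j (c + Pi.single l 1) ∧
      ((∀ k < l, c k = 0) → α = qint (c l + 1)) :=
  colProd_mul_seg hj hc hl hlj hlB _ (by push_cast; omega)

/-- The span of the `colMon B j c' * a` with `c'` a column between `i` and `j` satisfying `p` and
`a` in `fAlg i j`. -/
def colSpan (B : ℕ) (i j : ℤ) (p : (ℤ → ℕ) → Prop) : Submodule K U :=
  Submodule.span K {x | ∃ c', IsCol i j c' ∧ p c' ∧ ∃ a ∈ fAlg i j, x = colMon B j c' * a}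

theorem colMon_mul_mem_colSpan {B : ℕ} {i j : ℤ} {p : (ℤ → ℕ) → Prop} {c : ℤ → ℕ} {a : U}
    (hc : IsCol i j c) (hp : p c) (ha : a ∈ fAlg i j) : colMon B j c * a ∈ colSpan B i j p :=
  Submodule.subset_span ⟨c, hc, hp, a, ha, rfl⟩

theorem colSpan_mono {B : ℕ} {i i' j : ℤ} {p : (ℤ → ℕ) → Prop} (h : i' ≤ i) :
    colSpan B i j p ≤ colSpan B i' j p :=
  Submodule.span_mono fun _ ⟨c, hc, hp, a, ha, hx⟩ =>
    ⟨c, hc.mono h le_rfl, hp, a, fAlg_mono h le_rfl ha, hx⟩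

theorem colMon_mul_segSpan {B : ℕ} {l₀ i j : ℤ} (hj : Odd j) (hBi : -(B : ℤ) ≤ i) (hjB : j ≤ B)
    {p : (ℤ → ℕ) → Prop} {c : ℤ → ℕ} (hc : IsCol i j c) (hi : i ≤ l₀)
    (hp : ∀ l, l₀ ≤ l → p (c + Pi.single l 1)) {y : U} (hy : y ∈ segSpan l₀ i j) :
    colMon B j c * y ∈ colSpan B i j p := by
  refine mem_span_of_generators (LinearMap.mulLeft K (colMon B j c)) ?_ hy
  rintro _ ⟨l, hl, h1, h2, a, ha, rfl⟩
  obtain ⟨α, hα, -⟩ := colMon_mul_seg (B := B) hj hc hl h2 (by omega) (by omega)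
  rw [LinearMap.mulLeft_apply, ← mul_assoc, hα, smul_mul_assoc]
  exact Submodule.smul_mem _ _
    (colMon_mul_mem_colSpan (hc.add_single hl (hi.trans h1) h2) (hp l h1) ha)

theorem colSpan_mul_segSpan {B : ℕ} {i j : ℤ} (hj : Odd j) (hBi : -(B : ℤ) ≤ i) (hjB : j ≤ B)
    {p p' : (ℤ → ℕ) → Prop} (hp : ∀ c l, i ≤ l → p c → p' (c + Pi.single l 1)) {x y : U}
    (hx : x ∈ colSpan B i j p) (hy : y ∈ segSpan i i j) : x * y ∈ colSpan B i j p' := by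
  refine mem_span_of_generators (LinearMap.mulRight K y) ?_ hx
  rintro _ ⟨c, hc, hpc, a, ha, rfl⟩
  rw [LinearMap.mulRight_apply, mul_assoc]
  exact colMon_mul_segSpan hj hBi hjB hc le_rfl (fun l hl => hp c l hl hpc)
    (mul_mem_segSpan hj ha hy)

theorem colSpan_mul_mem {B : ℕ} {i j : ℤ} {p : (ℤ → ℕ) → Prop} {x a : U}
    (hx : x ∈ colSpan B i j p) (ha : a ∈ fAlg i j) : x * a ∈ colSpan B i j p := by
  refine mem_span_of_generators (LinearMap.mulRight K a) ?_ hx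
  rintro _ ⟨c, hc, hpc, b, hb, rfl⟩
  rw [LinearMap.mulRight_apply, mul_assoc]
  exact colMon_mul_mem_colSpan hc hpc (mul_mem hb ha)

theorem fAlg_le_colSpan {B : ℕ} {i j : ℤ} (hj : Odd j) (hBi : -(B : ℤ) ≤ i) (hij : i ≤ j)
    (hjB : j ≤ B) {x : U} (hx : x ∈ fAlg i (j + 1)) : x ∈ colSpan B i j fun _ => True := by
  have key : ∀ y ∈ colSpan B i j fun _ => True, y * x ∈ colSpan B i j fun _ => True := by
    induction hx using Algebra.adjoin_induction with
    | mem x hx =>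
      obtain ⟨k, hk, hik, hkj, rfl⟩ := hx
      intro y hy
      obtain rfl | h : k = j ∨ k < j := by omega
      · refine colSpan_mul_segSpan hj hBi hjB (fun _ _ _ _ => trivial) hy ?_
        rw [← seg_self]
        exact seg_mem_segSpan hj hik le_rfl
      · exact colSpan_mul_mem hy (fgen_mem_fAlg hk hik h)
    | algebraMap r =>
      intro y hy
      rw [← Algebra.commutes, ← Algebra.smul_def]
      exact Submodule.smul_mem _ _ hy
    | add a b _ _ ha hb =>
      intro y hy
      rw [mul_add]
      exact add_mem (ha y hy) (hb y hy)
    | mul a b _ _ ha hb =>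
      intro y hy
      rw [← mul_assoc]
      exact hb _ (ha y hy)
  rw [← one_mul x]
  refine key 1 ?_
  have := colMon_mul_mem_colSpan (B := B) (p := fun _ => True) (IsCol.zero i j) trivial
    (one_mem (fAlg i j))
  rwa [colMon, colProd_zero, mul_one] at this

theorem colMon_mem_fAlg {B : ℕ} {i j : ℤ} {c : ℤ → ℕ} (hj : Odd j) (hc : IsCol i j c) {j' : ℤ}
    (hj' : j < j') : colMon B j c ∈ fAlg i j' := by
  refine list_prod_mem fun x hx => ?_
  obtain ⟨b, -, rfl⟩ := List.mem_map.1 hx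
  by_cases h0 : c ((B : ℤ) - b) = 0
  · rw [h0, Nat.cast_zero, segPow_zero]; exact one_mem _
  · obtain ⟨h1, h2, h3⟩ := hc _ h0
    rw [segPow_natCast]
    exact Subalgebra.smul_mem _ (pow_mem (seg_mem_fAlg h1 hj h3 h2 hj') _) _

section Bar

variable {bar : U →+* U} (hbarq : bar (algebraMap K U q) = algebraMap K U q⁻¹)
  (hbarf : ∀ i : ℤ, Odd i → bar (fgen i) = fgen i)
include hbarq hbarf

theorem bar_colMon_add_single {B : ℕ} {i j : ℤ} (hi : Odd i) (hj : Odd j) (hBi : -(B : ℤ) ≤ i)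
    (hij : i ≤ j) (hjB : j ≤ B) {c : ℤ → ℕ} (hc : IsCol i j c)
    (h : bar (colMon B j c) - colMon B j c ∈ colSpan B i j (ColLt · c)) :
    bar (colMon B j (c + Pi.single i 1)) - colMon B j (c + Pi.single i 1) ∈
      colSpan B i j (ColLt · (c + Pi.single i 1)) := by
  obtain ⟨α, hα, hα'⟩ := colMon_mul_seg (B := B) hj hc hi hij (by omega) hBi
  obtain rfl := hα' fun k hk => by
    by_contra h0
    have := (hc k h0).2.1
    omega
  have hg := bar_seg hbarq hbarf hi hj hij
  obtain ⟨f, hf⟩ : ∃ f, f = bar (colMon B j c) - colMon B j c := ⟨_, rfl⟩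
  obtain ⟨g, hg'⟩ : ∃ g, g = bar (seg i j) - seg i j := ⟨_, rfl⟩
  rw [← hf] at h
  rw [← hg'] at hg
  have key : qint (c i + 1) • (bar (colMon B j (c + Pi.single i 1)) -
      colMon B j (c + Pi.single i 1)) = colMon B j c * g + f * (seg i j + g) := by
    rw [smul_sub, ← hα, Algebra.smul_def, ← bar_qint hbarq, ← map_mul, ← Algebra.smul_def, ← hα,
      map_mul, ← sub_add_cancel (bar (colMon B j c)) (colMon B j c), ← hf,
      ← sub_add_cancel (bar (seg i j)) (seg i j), ← hg']
    noncomm_ring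
  rw [← Submodule.smul_mem_iff _ (qint_succ_ne_zero (c i)), key]
  refine add_mem ?_ ?_
  · have hp : ∀ l, i + 2 ≤ l → ColLt (c + Pi.single l 1) (c + Pi.single i 1) :=
      fun l hl => ColLt.single_add (by omega)
    exact colMon_mul_segSpan (p := (ColLt · (c + Pi.single i 1))) hj hBi hjB hc (by omega) hp hg
  · have hp : ∀ c' l, i ≤ l → ColLt c' c → ColLt (c' + Pi.single l 1) (c + Pi.single i 1) :=
      fun c' l hl h' => h'.add_single hc hl
    have hs : seg i j + g ∈ segSpan i i j :=
      add_mem (seg_mem_segSpan hi le_rfl hij) (segSpan_mono (by omega) le_rfl hg)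
    exact colSpan_mul_segSpan (p' := (ColLt · (c + Pi.single i 1))) hj hBi hjB hp h hs

theorem bar_colMon {B : ℕ} {i j : ℤ} (hj : Odd j) (hBi : -(B : ℤ) ≤ i)
    (hij : i ≤ j + 1) (hjB : j ≤ B) {c : ℤ → ℕ} (hc : IsCol i j c) :
    bar (colMon B j c) - colMon B j c ∈ colSpan B i j (ColLt · c) := by
  induction i, hij using Int.leInductionDown generalizing c with
  | base =>
    have : c = 0 := by
      ext k
      by_contra h
      obtain ⟨-, h1, h2⟩ := hc k h
      omega
    rw [this, colMon, colProd_zero, map_one, sub_self]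
    exact zero_mem _
  | pred i hij ih =>
    have drop : ∀ c, IsCol (i - 1) j c → c (i - 1) = 0 →
        bar (colMon B j c) - colMon B j c ∈ colSpan B (i - 1) j (ColLt · c) := by
      intro c hc h0
      refine colSpan_mono (by omega) (ih (by omega) fun k hk => ?_)
      obtain ⟨h1, h2, h3⟩ := hc k hk
      have : k ≠ i - 1 := fun h => hk (h ▸ h0)
      exact ⟨h1, by omega, h3⟩
    by_cases ho : Odd (i - 1)
    · generalize hn : c (i - 1) = n
      induction n generalizing c with
      | zero => exact drop c hc hn
      | succ n ihn =>
        obtain ⟨c', rfl⟩ : ∃ c', c = c' + Pi.single (i - 1) 1 :=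
          ⟨c - Pi.single (i - 1) 1, by
            ext k
            by_cases h : k = i - 1
            · subst h; simp [hn]
            · simp [h]⟩
        have hc' : IsCol (i - 1) j c' := fun k hk => hc k (by simp; omega)
        exact bar_colMon_add_single hbarq hbarf ho hj hBi (by omega) hjB hc'
          (ihn hc' (by simpa using hn))
    · exact drop c hc (by_contra fun h => ho (hc _ h).1)

end Bar

/-- The product of the columns `m j` for `-B ≤ j < s - B`, in decreasing order of `j`. -/
def rowProd (B s : ℕ) (m : ℤ → ℤ → ℕ) : U :=
  ((List.range s).map fun a : ℕ =>
    colMon B ((s : ℤ) - B - 1 - a) (m ((s : ℤ) - B - 1 - a))).prod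

/-- `m` is a multisegment, written as a family of columns, with all segments `⟨i,j⟩` satisfying
`-B ≤ i ≤ j < s - B`. -/
def IsRow (B s : ℕ) (m : ℤ → ℤ → ℕ) : Prop :=
  ∀ j i, m j i ≠ 0 → Odd j ∧ Odd i ∧ -(B : ℤ) ≤ i ∧ i ≤ j ∧ j < (s : ℤ) - B

/-- The crystal ordering on families of columns. -/
def RowLt (n m : ℤ → ℤ → ℕ) : Prop := ∃ j, ColLt (n j) (m j) ∧ ∀ k > j, n k = m k

theorem IsRow.isCol {B s : ℕ} {m : ℤ → ℤ → ℕ} (h : IsRow B s m) (j : ℤ) :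
    IsCol (-(B : ℤ)) j (m j) := fun i hi => ⟨(h j i hi).2.1, (h j i hi).2.2.1, (h j i hi).2.2.2.1⟩

theorem IsRow.odd {B s : ℕ} {m : ℤ → ℤ → ℕ} (h : IsRow B s m) {j : ℤ} (hj : m j ≠ 0) : Odd j := by
  obtain ⟨i, hi⟩ := Function.ne_iff.1 hj
  exact (h j i hi).1

theorem IsRow.update {B s : ℕ} {n : ℤ → ℤ → ℕ} (hn : IsRow B s n) {c : ℤ → ℕ}
    (hc : IsCol (-(B : ℤ)) ((s : ℤ) - B) c) (ho : c ≠ 0 → Odd ((s : ℤ) - B)) :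
    IsRow B (s + 1) (Function.update n ((s : ℤ) - B) c) := by
  intro j i h
  push_cast
  by_cases hj : j = (s : ℤ) - B
  · subst hj
    rw [Function.update_self] at h
    obtain ⟨h1, h2, h3⟩ := hc i h
    exact ⟨ho fun h0 => h (by rw [h0]; rfl), h1, h2, h3, by omega⟩
  · rw [Function.update_of_ne hj] at h
    obtain ⟨h1, h2, h3, h4, h5⟩ := hn j i h
    exact ⟨h1, h2, h3, h4, by omega⟩

theorem IsRow.update_zero {B s : ℕ} {m : ℤ → ℤ → ℕ} (hm : IsRow B (s + 1) m) :
    IsRow B s (Function.update m ((s : ℤ) - B) 0) := by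
  intro j i h
  by_cases hj : j = (s : ℤ) - B
  · subst hj
    simp at h
  · rw [Function.update_of_ne hj] at h
    obtain ⟨h1, h2, h3, h4, h5⟩ := hm j i h
    push_cast at h5
    exact ⟨h1, h2, h3, h4, by omega⟩

theorem rowProd_succ (B s : ℕ) (m : ℤ → ℤ → ℕ) :
    rowProd B (s + 1) m = colMon B ((s : ℤ) - B) (m ((s : ℤ) - B)) * rowProd B s m := by
  have e (a : ℕ) : ((s + 1 : ℕ) : ℤ) - B - 1 - (a + 1 : ℕ) = s - B - 1 - a := by push_cast; ring
  have e₀ : ((s + 1 : ℕ) : ℤ) - B - 1 - (0 : ℕ) = s - B := by push_cast; ring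
  rw [rowProd, List.range_succ_eq_map, List.map_cons, List.prod_cons, List.map_map, e₀]
  congr 2
  exact List.map_congr_left fun a _ => by simp only [Function.comp, Nat.succ_eq_add_one, e]

theorem rowProd_update (B s : ℕ) (m : ℤ → ℤ → ℕ) (c : ℤ → ℕ) :
    rowProd B s (Function.update m ((s : ℤ) - B) c) = rowProd B s m := by
  refine congrArg List.prod (List.map_congr_left fun a _ => ?_)
  rw [Function.update_of_ne (by omega)]

theorem colMon_mul_rowProd (B s : ℕ) (m : ℤ → ℤ → ℕ) (c : ℤ → ℕ) :
    colMon B ((s : ℤ) - B) c * rowProd B s m =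
      rowProd B (s + 1) (Function.update m ((s : ℤ) - B) c) := by
  rw [rowProd_succ, rowProd_update, Function.update_self]

theorem rowProd_mem_fAlg {B s : ℕ} {m : ℤ → ℤ → ℕ} (hm : IsRow B s m) :
    rowProd B s m ∈ fAlg (-B) ((s : ℤ) - B) := by
  refine list_prod_mem fun x hx => ?_
  obtain ⟨a, -, rfl⟩ := List.mem_map.1 hx
  by_cases h : m ((s : ℤ) - B - 1 - a) = 0
  · rw [h, colMon, colProd_zero]; exact one_mem _
  · exact colMon_mem_fAlg (hm.odd h) (hm.isCol _) (by omega)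

theorem fAlg_le_rowSpan {B s : ℕ} (hs : s ≤ 2 * B + 1) {x : U}
    (hx : x ∈ fAlg (-B) ((s : ℤ) - B)) :
    x ∈ Submodule.span K {x | ∃ n, IsRow B s n ∧ x = rowProd B s n} := by
  induction s generalizing x with
  | zero =>
    have h : fAlg (-B) (((0 : ℕ) : ℤ) - B) = ⊥ := by
      rw [fAlg, ← Algebra.adjoin_empty]
      congr 1
      ext x
      simp only [Set.mem_ofPred_eq, Set.mem_empty_iff_false, iff_false]
      rintro ⟨k, -, h1, h2, -⟩
      push_cast at h2
      omega
    rw [h, Algebra.mem_bot] at hx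
    obtain ⟨r, rfl⟩ := hx
    rw [Algebra.algebraMap_eq_smul_one]
    refine Submodule.smul_mem _ _ (Submodule.subset_span
      ⟨fun _ => 0, fun _ _ h => (h rfl).elim, ?_⟩)
    simp [rowProd]
  | succ s ih =>
    have step : ∀ c, IsCol (-(B : ℤ)) ((s : ℤ) - B) c → (c ≠ 0 → Odd ((s : ℤ) - B)) →
        ∀ a ∈ fAlg (-B) ((s : ℤ) - B), colMon B ((s : ℤ) - B) c * a ∈
          Submodule.span K {x | ∃ n, IsRow B (s + 1) n ∧ x = rowProd B (s + 1) n} := by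
      intro c hc ho a ha
      refine mem_span_of_generators (LinearMap.mulLeft K _) ?_ (ih (by omega) ha)
      rintro _ ⟨n, hn, rfl⟩
      rw [LinearMap.mulLeft_apply, colMon_mul_rowProd]
      exact Submodule.subset_span ⟨_, hn.update hc ho, rfl⟩
    have e : ((s + 1 : ℕ) : ℤ) - B = s - B + 1 := by push_cast; ring
    rw [e] at hx
    by_cases ho : Odd ((s : ℤ) - B)
    · refine mem_span_of_generators LinearMap.id ?_
        (fAlg_le_colSpan ho le_rfl (by omega) (by omega) hx)
      rintro _ ⟨c, hc, -, a, ha, rfl⟩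
      exact step c hc (fun _ => ho) a ha
    · have hx' : x ∈ fAlg (-B) ((s : ℤ) - B) := by
        refine Algebra.adjoin_mono ?_ hx
        rintro _ ⟨k, hk, h1, h2, rfl⟩
        have : k ≠ (s : ℤ) - B := fun h => ho (h ▸ hk)
        exact ⟨k, hk, h1, by omega, rfl⟩
      have := step 0 (IsCol.zero _ _) (fun h => (h rfl).elim) x hx'
      rwa [colMon, colProd_zero, one_mul] at this

theorem bar_rowProd {bar : U →+* U} (hbarq : bar (algebraMap K U q) = algebraMap K U q⁻¹)
    (hbarf : ∀ i : ℤ, Odd i → bar (fgen i) = fgen i) {B s : ℕ} (hs : s ≤ 2 * B + 1)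
    {m : ℤ → ℤ → ℕ} (hm : IsRow B s m) :
    bar (rowProd B s m) - rowProd B s m ∈
      Submodule.span K {x | ∃ n, IsRow B s n ∧ RowLt n m ∧ x = rowProd B s n} := by
  induction s generalizing m with
  | zero => simp [rowProd]
  | succ s ih =>
    obtain ⟨j, hj⟩ : ∃ j : ℤ, j = s - B := ⟨_, rfl⟩
    have hm' := hm.update_zero
    have hP := ih (by omega) hm'
    rw [rowProd_succ, ← rowProd_update B s m 0, ← hj]
    rw [← hj] at hm' hP
    generalize hP' : rowProd B s (Function.update m j 0) = P at hP
    have hPmem : P ∈ fAlg (-B) j := hP' ▸ hj ▸ rowProd_mem_fAlg (hj ▸ hm')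
    have hbarP : bar P ∈ fAlg (-B) j := by
      rw [← sub_add_cancel (bar P) P]
      refine add_mem ?_ hPmem
      refine mem_span_of_generators (p := Subalgebra.toSubmodule (fAlg (-B) j)) LinearMap.id ?_ hP
      rintro _ ⟨n, hn, -, rfl⟩
      exact hj ▸ rowProd_mem_fAlg hn
    have hcol : bar (colMon B j (m j)) - colMon B j (m j) ∈ colSpan B (-B) j (ColLt · (m j)) := by
      by_cases h0 : m j = 0
      · rw [h0, colMon, colProd_zero, map_one, sub_self]; exact zero_mem _
      · exact bar_colMon hbarq hbarf (hm.odd h0) le_rfl (by omega) (by omega) (hm.isCol j)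
    have e : bar (colMon B j (m j) * P) - colMon B j (m j) * P =
        (bar (colMon B j (m j)) - colMon B j (m j)) * bar P + colMon B j (m j) * (bar P - P) := by
      rw [map_mul, sub_mul, mul_sub]; abel
    rw [e]
    refine add_mem ?_ ?_
    · refine mem_span_of_generators (LinearMap.mulRight K (bar P)) ?_ hcol
      rintro _ ⟨c, hc, hlt, a, ha, rfl⟩
      have ho : Odd j := by
        obtain ⟨i, hi, -⟩ := hlt
        exact hm.odd fun h => by simp [h] at hi
      rw [LinearMap.mulRight_apply, mul_assoc]
      refine mem_span_of_generators (LinearMap.mulLeft K (colMon B j c)) ?_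
        (fAlg_le_rowSpan (by omega) (hj ▸ mul_mem ha hbarP))
      rintro _ ⟨n, hn, rfl⟩
      subst hj
      rw [LinearMap.mulLeft_apply, colMon_mul_rowProd]
      refine Submodule.subset_span ⟨_, hn.update hc fun _ => ho, ⟨(s : ℤ) - B, ?_, ?_⟩, rfl⟩
      · rwa [Function.update_self]
      · intro k hk
        rw [Function.update_of_ne hk.ne']
        ext i
        have h1 : n k i = 0 := by
          by_contra h
          have := (hn k i h).2.2.2.2
          omega
        have h2 : m k i = 0 := by
          by_contra h
          have := (hm k i h).2.2.2.2
          push_cast at this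
          omega
        rw [h1, h2]
    · refine mem_span_of_generators (LinearMap.mulLeft K (colMon B j (m j))) ?_ hP
      rintro _ ⟨n, hn, ⟨k, hk, hk'⟩, rfl⟩
      have hkj : k < j := by
        obtain ⟨i, hi, -⟩ := hk
        have h0 : Function.update m j 0 k i ≠ 0 := by omega
        exact hj ▸ (hm' k i h0).2.2.2.2
      have hcj := hm.isCol j
      have hoj := hm.odd (j := j)
      subst hj
      rw [LinearMap.mulLeft_apply, colMon_mul_rowProd]
      refine Submodule.subset_span ⟨_, hn.update hcj hoj, ⟨k, ?_, ?_⟩, rfl⟩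
      · rwa [Function.update_of_ne hkj.ne] at hk ⊢
      · intro l hl
        by_cases h : l = (s : ℤ) - B
        · rw [h, Function.update_self]
        · have := hk' l hl
          rwa [Function.update_of_ne h] at this ⊢

theorem List.prod_map_filter_of_eq_one {α M : Type*} [Monoid M] (g : α → M) (p : α → Bool)
    (l : List α) (h : ∀ x ∈ l, p x = false → g x = 1) :
    ((l.filter p).map g).prod = (l.map g).prod := by
  induction l with
  | nil => rfl
  | cons a l ih =>
    have ih := ih fun x hx => h x (List.mem_cons_of_mem _ hx)
    by_cases hp : p a = true
    · rw [List.filter_cons_of_pos hp, List.map_cons, List.map_cons, List.prod_cons,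
        List.prod_cons, ih]
    · rw [List.filter_cons_of_neg hp, List.map_cons, List.prod_cons,
        h a List.mem_cons_self (by simpa using hp), one_mul, ih]

theorem box_eq (N : ℕ) : box N = (List.range (2 * N + 1)).flatMap fun a : ℕ =>
    (List.range (2 * N + 1)).map fun b : ℕ => ((N : ℤ) - b, (N : ℤ) - a) := by
  simp [box, List.flatMap_assoc, List.map_eq_flatMap]

theorem mem_box {N : ℕ} {p : ℤ × ℤ} :
    p ∈ box N ↔ (-(N : ℤ) ≤ p.1 ∧ p.1 ≤ N) ∧ -(N : ℤ) ≤ p.2 ∧ p.2 ≤ N := by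
  simp only [box_eq, List.mem_flatMap, List.mem_map, List.mem_range, Prod.ext_iff]
  constructor
  · rintro ⟨a, ha, b, hb, h1, h2⟩
    omega
  · rintro ⟨h1, h2⟩
    exact ⟨(N - p.2).toNat, by omega, (N - p.1).toNat, by omega, by omega, by omega⟩

theorem box_pairwise (N : ℕ) :
    (box N).Pairwise fun x y => y.2 < x.2 ∨ y.2 = x.2 ∧ y.1 < x.1 := by
  rw [box_eq, List.pairwise_flatMap]
  refine ⟨fun a _ => ?_, ?_⟩
  · rw [List.pairwise_map]
    exact List.pairwise_lt_range.imp fun h => Or.inr ⟨rfl, by simpa using h⟩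
  · refine List.pairwise_lt_range.imp fun {a b} h x hx y hy => Or.inl ?_
    obtain ⟨_, -, rfl⟩ := List.mem_map.1 hx
    obtain ⟨_, -, rfl⟩ := List.mem_map.1 hy
    simpa using h

theorem box_filter_eq {N N' : ℕ} (p : ℤ × ℤ → Bool)
    (h : ∀ x, p x = true → (x ∈ box N ↔ x ∈ box N')) :
    (box N).filter p = (box N').filter p := by
  have hn (M : ℕ) : (box M).Nodup := (box_pairwise M).imp fun {a b} h hab => by
    subst hab
    omega
  refine List.Perm.eq_of_pairwise ?_ ((box_pairwise N).filter p) ((box_pairwise N').filter p)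
    ((List.perm_ext_iff_of_nodup ((hn N).filter p) ((hn N').filter p)).2 fun x => ?_)
  · intro a b _ _ h1 h2
    omega
  · simp only [List.mem_filter]
    exact and_congr_left (h x)

theorem natAbs_le_bound {m : MS} {i j : ℤ} (h : m (i, j) ≠ 0) :
    i.natAbs ≤ bound m ∧ j.natAbs ≤ bound m := by
  have := Finset.le_sup (f := fun p : ℤ × ℤ => max p.1.natAbs p.2.natAbs)
    (Finsupp.mem_support_iff.2 h)
  exact ⟨(le_max_left _ _).trans this, (le_max_right _ _).trans this⟩

theorem Pms_eq_rowProd {m : MS} {B : ℕ} (hB : bound m ≤ B) {c : ℤ → ℤ → ℕ}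
    (hc : ∀ i j, m (i, j) = c j i) : Pms m = rowProd B (2 * B + 1) c := by
  have hfilter (N : ℕ) := List.prod_map_filter_of_eq_one (fun p => segPow p.1 p.2 (m p))
    (fun p => decide (m p ≠ 0)) (box N) fun x _ hx => by
      have h0 : m x = 0 := by simpa using hx
      rw [h0, segPow_zero]
  rw [Pms, ← hfilter, box_filter_eq (N' := B), hfilter]
  · rw [box_eq, List.map_flatMap, List.flatMap, List.prod_flatten, List.map_map, rowProd]
    refine congrArg List.prod (List.map_congr_left fun a _ => ?_)
    have e : ((2 * B + 1 : ℕ) : ℤ) - B - 1 - a = B - a := by push_cast; ring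
    simp only [Function.comp, List.map_map, colMon, colProd, e, hc]
    rfl
  · rintro ⟨i, j⟩ hx
    have := natAbs_le_bound (of_decide_eq_true hx)
    simp only [mem_box]
    omega

/-- The multisegment with the given columns. -/
def rowMS {B s : ℕ} {c : ℤ → ℤ → ℕ} (hc : IsRow B s c) : MS :=
  Finsupp.onFinset (Finset.Icc (-(B : ℤ)) (s - B) ×ˢ Finset.Icc (-(B : ℤ)) (s - B))
    (fun p => (c p.2 p.1 : ℤ)) fun p hp => by
      obtain ⟨-, -, h1, h2, h3⟩ := hc p.2 p.1 (by exact_mod_cast hp)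
      simp only [Finset.mem_product, Finset.mem_Icc]
      omega

theorem rowMS_apply {B s : ℕ} {c : ℤ → ℤ → ℕ} (hc : IsRow B s c) (i j : ℤ) :
    rowMS hc (i, j) = c j i := rfl

theorem rowMS_isMulti {B s : ℕ} {c : ℤ → ℤ → ℕ} (hc : IsRow B s c) : IsMulti (rowMS hc) := by
  intro i j h
  rw [rowMS_apply] at h ⊢
  obtain ⟨h1, h2, -, h3, -⟩ := hc j i (by exact_mod_cast h)
  exact ⟨h2, h1, h3, by omega⟩

theorem bound_rowMS_le {B : ℕ} {c : ℤ → ℤ → ℕ} (hc : IsRow B (2 * B + 1) c) :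
    bound (rowMS hc) ≤ B := by
  refine Finset.sup_le fun p hp => ?_
  obtain ⟨-, -, h1, h2, h3⟩ := hc p.2 p.1 (by
    have h : (c p.2 p.1 : ℤ) ≠ 0 := Finsupp.mem_support_iff.1 hp
    exact_mod_cast h)
  push_cast at h3
  exact max_le (by omega) (by omega)

/-- Proposition 5.3 of Enomoto–Kashiwara: the bar involution (the unique ℚ-algebra
automorphism of `U_q^-(gl_∞)` with `q ↦ q⁻¹` and `f_i ↦ f_i`) is upper triangular on
the PBW basis: `bar(P(m)) ∈ P(m) + Σ_{n <_cry m} K·P(n)`. -/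
theorem bar_triangular_on_PBW (bar : U →+* U)
    (hbarq : bar (algebraMap K U q) = algebraMap K U q⁻¹)
    (hbarrat : ∀ r : ℚ, bar (algebraMap ℚ U r) = algebraMap ℚ U r)
    (hbarf : ∀ i : ℤ, Odd i → bar (fgen i) = fgen i)
    (m : MS) (hm : IsMulti m) :
    bar (Pms m) - Pms m ∈
      Submodule.span K {x : U | ∃ n : MS, IsMulti n ∧ CryLt n m ∧ x = Pms n} := by
  have hc : ∀ i j, m (i, j) = (m (i, j)).toNat := fun i j => by
    by_cases h : m (i, j) = 0
    · simp [h]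
    · have := (hm i j h).2.2.2
      omega
  have hrow : IsRow (bound m) (2 * bound m + 1) fun j i => (m (i, j)).toNat := by
    intro j i h
    have h0 : m (i, j) ≠ 0 := fun h' => h (by simp [h'])
    obtain ⟨h1, h2, h3, -⟩ := hm i j h0
    have := natAbs_le_bound h0
    push_cast
    exact ⟨h2, h1, by omega, h3, by omega⟩
  rw [Pms_eq_rowProd le_rfl hc]
  refine Submodule.span_mono ?_ (bar_rowProd hbarq hbarf le_rfl hrow)
  rintro _ ⟨n, hn, ⟨j, ⟨i, hi, hi'⟩, hj⟩, rfl⟩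
  refine ⟨rowMS hn, rowMS_isMulti hn, ⟨i, j, (hrow j i (by omega)).2.2.2.1, ?_, ?_, ?_⟩,
    (Pms_eq_rowProd (bound_rowMS_le hn) fun _ _ => rfl).symm⟩
  · rw [rowMS_apply, hc]
    exact_mod_cast hi
  · intro k hk
    rw [rowMS_apply, hc, hi' k hk]
  · intro k l hl _
    rw [rowMS_apply, hc, hj l hl]

end
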